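/- arXiv:2503.10319 — 2 statements merged into one kernel-verified Lean document; each statement's English description precedes it below -/
import Mathlib

section
/- Let μ be a non-Dirac Borel probability measure on [0,∞), let p be a positive integer with m_p(μ) < +∞, and for each n ∈ ℕ let ν_n be a Borel probability measure on [0,∞) realizing μ^{⊠ n}. Then lim_{n→∞} n^{1−p} · m_p(ν_n)/m₁(μ)^{p n} = (η p)^{p−1} / p!, where η = Var(μ)/m₁(μ)² (for p = 1 the right-hand side is interpreted as 1; for p ≥ 2, m₂(μ) < +∞ so η is finite). -/
open MeasureTheory Filter Topology Real

/-- The moment transform `ψ_μ(z) = ∫ z t / (1 - z t) dμ(t)` of a measure on `ℝ`. -/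
noncomputable def psi (μ : Measure ℝ) (z : ℝ) : ℝ := ∫ t, z * t / (1 - z * t) ∂μ

/-- `ν` realizes the `n`-fold free multiplicative convolution `μ^{⊠ n}`: with
`δ = μ({0})`, there is an inverse `χ : (δ-1,0) → (-∞,0)` of `ψ_μ` such that
`ψ_ν(((z+1)/z)^{n-1} · χ(z)^n) = z` on `(δ-1,0)` (this encodes `S_{μ^{⊠n}} = S_μ^n`). -/
def RealizesFreePower (μ ν : Measure ℝ) (n : ℕ) : Prop :=
  ∃ χ : ℝ → ℝ,
    (∀ z ∈ Set.Ioo ((μ {0}).toReal - 1) 0, χ z < 0 ∧ psi μ (χ z) = z) ∧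
    (∀ z ∈ Set.Ioo ((μ {0}).toReal - 1) 0,
      psi ν (((z + 1) / z) ^ (n - 1) * (χ z) ^ n) = z)

section Expansions
open Asymptotics Polynomial

/-- `f` agrees with the polynomial `P` up to `o(w ^ N)` as `w → 0⁻`. -/
def ExpandsLeft (f : ℝ → ℝ) (P : ℝ[X]) (N : ℕ) : Prop :=
  (fun w => f w - P.eval w) =o[𝓝[<] 0] fun w => w ^ N

theorem eval_isBigO_one (P : ℝ[X]) {f : ℝ → ℝ} (hf : Tendsto f (𝓝[<] 0) (𝓝 0)) :
    (fun w => P.eval (f w)) =O[𝓝[<] 0] fun _ => (1 : ℝ) :=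
  ((P.continuous.tendsto 0).comp hf).isBigO_one ℝ

theorem tendsto_id_nhdsLT_zero : Tendsto (fun w : ℝ => w) (𝓝[<] 0) (𝓝 0) :=
  tendsto_id.mono_left nhdsWithin_le_nhds

theorem pow_isBigO_pow_nhdsLT {m n : ℕ} (h : m ≤ n) :
    (fun w : ℝ => w ^ n) =O[𝓝[<] 0] fun w => w ^ m := by
  obtain ⟨k, rfl⟩ := Nat.exists_eq_add_of_le h
  have h1 : (fun w : ℝ => w ^ k) =O[𝓝[<] 0] fun _ => (1 : ℝ) := by
    have := (tendsto_id_nhdsLT_zero.pow k).isBigO_one ℝ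
    exact this
  simpa [pow_add] using (isBigO_refl (fun w : ℝ => w ^ m) (𝓝[<] 0)).mul h1

theorem eval_isBigO_pow {P : ℝ[X]} {N : ℕ} (h : ∀ k < N, P.coeff k = 0) :
    (fun w => P.eval w) =O[𝓝[<] 0] fun w => w ^ N := by
  obtain ⟨Q, rfl⟩ := X_pow_dvd_iff.2 h
  simpa using (isBigO_refl (fun w : ℝ => w ^ N) (𝓝[<] 0)).mul
    (eval_isBigO_one Q tendsto_id_nhdsLT_zero)

theorem coeff_eq_zero_of_eval_isLittleO {P : ℝ[X]} {N : ℕ}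
    (h : (fun w => P.eval w) =o[𝓝[<] 0] fun w => w ^ N) : ∀ k ≤ N, P.coeff k = 0 := by
  induction N generalizing P with
  | zero =>
    intro k hk
    obtain rfl : k = 0 := by omega
    simp only [pow_zero, isLittleO_one_iff] at h
    rw [coeff_zero_eq_eval_zero]
    exact tendsto_nhds_unique ((P.continuous.tendsto 0).comp tendsto_id_nhdsLT_zero) h
  | succ N ih =>
    have h0 : P.coeff 0 = 0 := by
      exact ih (h.trans_isBigO (pow_isBigO_pow_nhdsLT N.le_succ)) 0 N.zero_le
    obtain ⟨Q, rfl⟩ := X_dvd_iff.2 h0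
    have hQ : (fun w => Q.eval w) =o[𝓝[<] 0] fun w => w ^ N := by
      have := (isBigO_refl (fun w : ℝ => w⁻¹) (𝓝[<] 0)).mul_isLittleO h
      refine this.congr' ?_ ?_
      · filter_upwards [self_mem_nhdsWithin] with w hw
        have : w ≠ 0 := ne_of_lt hw
        simp only [eval_mul, eval_X]
        field_simp
      · filter_upwards [self_mem_nhdsWithin] with w hw
        have : w ≠ 0 := ne_of_lt hw
        field_simp
        ring
    intro k hk
    cases k with
    | zero => exact h0
    | succ k => rw [coeff_X_mul]; exact ih hQ k (by omega)

namespace ExpandsLeft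
variable {f g : ℝ → ℝ} {P Q : ℝ[X]} {N : ℕ}

theorem of_polynomial (P : ℝ[X]) (N : ℕ) : ExpandsLeft (fun w => P.eval w) P N := by
  simp [ExpandsLeft]

theorem sub (hf : ExpandsLeft f P N) (hg : ExpandsLeft g Q N) :
    ExpandsLeft (fun w => f w - g w) (P - Q) N := by
  refine (IsLittleO.sub hf hg).congr_left fun w => ?_
  simp; ring

theorem mono {M : ℕ} (hf : ExpandsLeft f P N) (h : M ≤ N) : ExpandsLeft f P M :=
  hf.trans_isBigO (pow_isBigO_pow_nhdsLT h)

theorem isBigO_one (hf : ExpandsLeft f P N) : f =O[𝓝[<] 0] fun _ => (1 : ℝ) := by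
  have h1 := (hf.mono N.zero_le).isBigO.add
    ((eval_isBigO_one P tendsto_id_nhdsLT_zero).congr_right (g₂ := fun w => w ^ 0) (by simp))
  simpa using h1

theorem mul (hf : ExpandsLeft f P N) (hg : ExpandsLeft g Q N) :
    ExpandsLeft (fun w => f w * g w) (P * Q) N := by
  have h1 := (IsLittleO.mul_isBigO hf hg.isBigO_one).add
    ((eval_isBigO_one P tendsto_id_nhdsLT_zero).mul_isLittleO hg |>.congr_right
      (g₂ := fun w => w ^ N * 1) (by simp))
  simp only [mul_one] at h1
  refine h1.congr_left fun w => ?_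
  simp; ring

theorem pow (hf : ExpandsLeft f P N) (k : ℕ) :
    ExpandsLeft (fun w => f w ^ k) (P ^ k) N := by
  induction k with
  | zero => simpa using of_polynomial 1 N
  | succ k ih => simpa only [pow_succ] using ih.mul hf

theorem polynomial_comp (hf : ExpandsLeft f P N) (R : ℝ[X]) :
    ExpandsLeft (fun w => R.eval (f w)) (R.comp P) N := by
  induction R using Polynomial.induction_on' with
  | add R S hR hS =>
    refine (IsLittleO.add hR hS).congr_left fun w => ?_
    simp; ring
  | monomial n a =>
    refine (((hf.pow n).const_mul_left a)).congr_left fun w => ?_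
    simp [mul_sub]

theorem congr' (hf : ExpandsLeft f P N) (h : f =ᶠ[𝓝[<] 0] g) : ExpandsLeft g P N :=
  IsLittleO.congr' hf (h.mono fun w hw => by simp [hw]) EventuallyEq.rfl

theorem X_mul (hf : ExpandsLeft f P N) : ExpandsLeft (fun w => w * f w) (X * P) (N + 1) := by
  refine ((isBigO_refl (fun w : ℝ => w) (𝓝[<] 0)).mul_isLittleO hf).congr (fun w => ?_)
    fun w => (pow_succ' w N).symm
  simp; ring

theorem div_self (hf : ExpandsLeft f (X * P) (N + 1)) :
    ExpandsLeft (fun w => f w / w) P N := by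
  refine ((isBigO_refl (fun w : ℝ => w⁻¹) (𝓝[<] 0)).mul_isLittleO hf).congr' ?_ ?_
  · filter_upwards [self_mem_nhdsWithin] with w hw
    have : w ≠ 0 := ne_of_lt hw
    simp only [eval_mul, eval_X]
    field_simp
  · filter_upwards [self_mem_nhdsWithin] with w hw
    have : w ≠ 0 := ne_of_lt hw
    field_simp
    ring

theorem isBigO_pow (hf : ExpandsLeft f P N) (h : ∀ k < N, P.coeff k = 0) :
    f =O[𝓝[<] 0] fun w => w ^ N := by
  simpa using hf.isBigO.add (eval_isBigO_pow h)

theorem coeff_eq_zero (hf : ExpandsLeft f P N) (h : f =o[𝓝[<] 0] fun w => w ^ N) :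
    ∀ k ≤ N, P.coeff k = 0 :=
  coeff_eq_zero_of_eval_isLittleO (by simpa using h.sub hf)

end ExpandsLeft

/-- An asymptotic compositional inverse of a polynomial with nonzero linear coefficient. -/
theorem exists_expandsLeft_of_eval_sub_isLittleO (B : ℝ[X]) {c : ℝ} (hc : c ≠ 0) (p : ℕ) :
    ∃ a : ℝ[X], ∀ χ : ℝ → ℝ, χ =O[𝓝[<] 0] (fun w => w) →
      (fun w => (C c * X + X ^ 2 * B).eval (χ w) - w) =o[𝓝[<] 0] (fun w => w ^ p) →
      ExpandsLeft χ (X * a) p := by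
  suffices H : ∀ j ≤ p, ∃ A : ℝ[X], A.coeff 0 = 0 ∧
      ∀ χ : ℝ → ℝ, χ =O[𝓝[<] 0] (fun w => w) →
      (fun w => (C c * X + X ^ 2 * B).eval (χ w) - w) =o[𝓝[<] 0] (fun w => w ^ p) →
      ExpandsLeft χ A j by
    obtain ⟨A, hA, hχA⟩ := H p le_rfl
    obtain ⟨a, rfl⟩ := X_dvd_iff.2 hA
    exact ⟨a, hχA⟩
  intro j
  induction j with
  | zero =>
    refine fun _ => ⟨0, by simp, fun χ hχ _ => ?_⟩
    simpa [ExpandsLeft] using hχ.trans_tendsto tendsto_id_nhdsLT_zero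
  | succ j ih =>
    intro hj
    obtain ⟨A, hA0, hA⟩ := ih (by omega)
    refine ⟨C c⁻¹ * (X - (X ^ 2 * B).comp A), by
      simp [coeff_zero_eq_eval_zero, ← coeff_zero_eq_eval_zero A, hA0], fun χ hχ h => ?_⟩
    have hAO : (fun w => A.eval w) =O[𝓝[<] 0] fun w => w := by
      simpa using eval_isBigO_pow (P := A) (N := 1) (by
        intro k hk; obtain rfl : k = 0 := by omega
        exact hA0)
    have hE : ExpandsLeft (fun w => (X * B).eval (χ w)) ((X * B).comp A) j :=
      (hA χ hχ h).polynomial_comp _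
    have hEO : (fun w => (X * B).eval (A.eval w)) =O[𝓝[<] 0] fun w => w := by
      simpa using hAO.mul (eval_isBigO_one B (hAO.trans_tendsto tendsto_id_nhdsLT_zero))
    have h1 : (fun w => χ w * ((X * B).eval (χ w) - ((X * B).comp A).eval w)
        + (χ w - A.eval w) * (X * B).eval (A.eval w)) =o[𝓝[<] 0] fun w => w ^ (j + 1) := by
      refine IsLittleO.add ?_ ?_
      · simpa only [pow_succ'] using hχ.mul_isLittleO hE
      · simpa only [pow_succ] using IsLittleO.mul_isBigO (hA χ hχ h) hEO
    refine (((h.trans_isBigO (pow_isBigO_pow_nhdsLT hj)).sub h1).const_mul_left c⁻¹).congr_left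
      fun w => ?_
    simp
    field_simp
    ring

end Expansions

section FormalPart
open PowerSeries

theorem coeff_pow_mul_one_add_X_mul_derivative {g h : PowerSeries ℝ} (hgh : g * h = 1)
    (i k : ℕ) :
    ((i : ℝ) + 1) * coeff k (h ^ (i + 1) * (1 + X * (derivative ℝ g * h))) =
      ((i : ℝ) + 1 - k) * coeff k (h ^ (i + 1)) := by
  have hd : derivative ℝ g * h = -(g * derivative ℝ h) := by
    have := congrArg (derivative ℝ) hgh
    rw [Derivation.leibniz, Derivation.map_one_eq_zero, smul_eq_mul, smul_eq_mul] at this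
    linear_combination this
  have hk : derivative ℝ (h ^ (i + 1)) = (i + 1 : ℕ) * h ^ i * derivative ℝ h := by
    rw [derivative_pow]; simp
  have e : C ((i : ℝ) + 1) * (h ^ (i + 1) * (1 + X * (derivative ℝ g * h))) =
      C ((i : ℝ) + 1) * h ^ (i + 1) - X * derivative ℝ (h ^ (i + 1)) := by
    rw [hd, hk]
    have : C ((i : ℝ) + 1) = (((i + 1 : ℕ) : PowerSeries ℝ)) := by simp
    rw [this]
    linear_combination (-((i + 1 : ℕ) : PowerSeries ℝ) * X * h ^ i * derivative ℝ h) * hgh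
  have := congrArg (coeff k) e
  rw [coeff_C_mul, map_sub, coeff_C_mul] at this
  rw [this]
  cases k with
  | zero => simp
  | succ k => rw [coeff_succ_X_mul, coeff_derivative]; push_cast; ring

theorem lagrange_inversion_of_coeff_eq {g h : PowerSeries ℝ} (hgh : g * h = 1) (M : ℕ → ℝ)
    {p : ℕ} (hp : 0 < p)
    (H : ∀ k ≤ p, coeff k (∑ j ∈ Finset.range p, C (M (j + 1)) * (X * g) ^ (j + 1)) =
      coeff k (X : PowerSeries ℝ)) :
    p * M p = coeff (p - 1) (h ^ p) := by
  obtain ⟨m, rfl⟩ : ∃ m, p = m + 1 := ⟨p - 1, by omega⟩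
  obtain ⟨D, hD⟩ : (X : PowerSeries ℝ) ^ (m + 2) ∣
      ∑ j ∈ Finset.range (m + 1), C (M (j + 1)) * (X * g) ^ (j + 1) - X := by
    rw [X_pow_dvd_iff]
    intro k hk
    rw [map_sub, H k (by omega), sub_self]
  set U := 1 + X * (derivative ℝ g * h) with hU
  have key : coeff (m + 1)
      ((∑ j ∈ Finset.range (m + 1), C (M (j + 1)) * (X * g) ^ (j + 1) - X) * (h ^ (m + 1) * U))
        = 0 := by
    rw [hD, mul_assoc, coeff_X_pow_mul']
    simp
  have hterm : ∀ j ∈ Finset.range (m + 1),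
      coeff (m + 1) (C (M (j + 1)) * (X * g) ^ (j + 1) * (h ^ (m + 1) * U)) =
        if j = m then M (j + 1) else 0 := by
    intro j hj
    obtain ⟨i, rfl⟩ : ∃ i, m = j + i := ⟨m - j, by have := Finset.mem_range.1 hj; omega⟩
    have e : C (M (j + 1)) * (X * g) ^ (j + 1) * (h ^ (j + i + 1) * U) =
        C (M (j + 1)) * (X ^ (j + 1) * (h ^ i * U)) := by
      have : (g * h) ^ (j + 1) = 1 := by rw [hgh, one_pow]
      rw [mul_pow] at this
      rw [mul_pow]
      linear_combination (C (M (j + 1)) * X ^ (j + 1) * h ^ i * U) * this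
    rw [e, coeff_C_mul, show j + i + 1 = i + (j + 1) by ring, coeff_X_pow_mul]
    rcases i with _ | i
    · simp [hU]
    · have := coeff_pow_mul_one_add_X_mul_derivative hgh i (i + 1)
      push_cast at this
      rw [sub_self, zero_mul] at this
      rw [(mul_eq_zero.1 this).resolve_left (by positivity)]
      simp
  rw [sub_mul, map_sub, Finset.sum_mul, map_sum, Finset.sum_congr rfl hterm,
    coeff_succ_X_mul] at key
  simp only [Finset.sum_ite_eq', Finset.mem_range, Nat.lt_succ_self, if_true] at key
  have := coeff_pow_mul_one_add_X_mul_derivative hgh m m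
  rw [← hU] at this
  push_cast [Nat.add_sub_cancel]
  linear_combination ((m : ℝ) + 1) * key + this

theorem tendsto_choose_div_pow (i j : ℕ) (hij : i ≤ j) :
    Tendsto (fun N : ℕ => (N.choose i : ℝ) / (N : ℝ) ^ j) atTop
      (𝓝 (if i = j then 1 / (j.factorial : ℝ) else 0)) := by
  have h1 : Tendsto (fun N : ℕ => (N.choose i : ℝ) / (N : ℝ) ^ i) atTop
      (𝓝 (1 / (i.factorial : ℝ))) := by
    have := ProbabilityTheory.tendsto_choose_mul_pow_atTop (p := fun n => (n : ℝ)⁻¹) (r := 1) i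
      (tendsto_const_nhds.congr' (by
        filter_upwards [eventually_gt_atTop 0] with n hn
        rw [mul_inv_cancel₀ (by positivity)]))
    simpa [div_eq_mul_inv] using this
  split_ifs with h
  · subst h; exact h1
  · have h2 : Tendsto (fun N : ℕ => ((N : ℝ)⁻¹) ^ (j - i)) atTop (𝓝 0) := by
      have := (tendsto_inv_atTop_nhds_zero_nat (𝕜 := ℝ)).pow (j - i)
      rwa [zero_pow (by omega)] at this
    have := h1.mul h2
    rw [mul_zero] at this
    refine this.congr fun N => ?_
    rw [div_eq_mul_inv, div_eq_mul_inv, mul_assoc, inv_pow, ← mul_inv, ← pow_add,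
      Nat.add_sub_cancel' hij]

theorem tendsto_coeff_mul_pow_div (A q : PowerSeries ℝ) (hA : constantCoeff A = 1)
    (hq : constantCoeff q = 1) (j : ℕ) :
    Tendsto (fun N : ℕ => coeff j (A * q ^ N) / (N : ℝ) ^ j) atTop
      (𝓝 (coeff 1 q ^ j / (j.factorial : ℝ))) := by
  obtain ⟨r, hr⟩ : X ∣ q - 1 := by
    rw [X_dvd_iff]; simp [hq]
  have hq' : q = X * r + 1 := by rw [← hr]; ring
  have hr0 : coeff 1 q = constantCoeff r := by
    rw [hq', map_add]
    simp [coeff_one]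
  have hexp : ∀ N, j ≤ N → coeff j (A * q ^ N) =
      ∑ i ∈ Finset.range (j + 1), (N.choose i : ℝ) * coeff (j - i) (A * r ^ i) := by
    intro N hN
    have e : A * q ^ N = ∑ i ∈ Finset.range (N + 1),
        C (N.choose i : ℝ) * (X ^ i * (A * r ^ i)) := by
      rw [hq', add_pow, Finset.mul_sum]
      refine Finset.sum_congr rfl fun i _ => ?_
      rw [one_pow, mul_pow, map_natCast]
      ring
    rw [e, map_sum]
    symm
    refine Finset.sum_subset_zero_on_sdiff (Finset.range_subset_range.2 (by omega)) ?_ ?_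
    · intro i hi
      simp only [Finset.mem_sdiff, Finset.mem_range] at hi
      rw [coeff_C_mul, coeff_X_pow_mul', if_neg (by omega), mul_zero]
    · intro i hi
      simp only [Finset.mem_range] at hi
      rw [coeff_C_mul, coeff_X_pow_mul', if_pos (by omega)]
  have hlim : Tendsto (fun N : ℕ => ∑ i ∈ Finset.range (j + 1),
      (N.choose i : ℝ) / (N : ℝ) ^ j * coeff (j - i) (A * r ^ i)) atTop
      (𝓝 (∑ i ∈ Finset.range (j + 1),
        (if i = j then 1 / (j.factorial : ℝ) else 0) * coeff (j - i) (A * r ^ i))) :=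
    tendsto_finsetSum _ fun i hi =>
      (tendsto_choose_div_pow i j (by have := Finset.mem_range.1 hi; omega)).mul_const _
  have hval : (∑ i ∈ Finset.range (j + 1),
      (if i = j then 1 / (j.factorial : ℝ) else 0) * coeff (j - i) (A * r ^ i)) =
        coeff 1 q ^ j / (j.factorial : ℝ) := by
    simp [hr0, hA, ite_mul]
    ring
  rw [hval] at hlim
  refine hlim.congr' ?_
  filter_upwards [eventually_ge_atTop j] with N hN
  rw [hexp N hN, Finset.sum_div]
  exact Finset.sum_congr rfl fun i _ => by ring

end FormalPart

section MomentTransform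
variable {ρ : Measure ℝ}

theorem abs_mul_div_one_sub_le {z t : ℝ} (hz : z ≤ 0) (ht : 0 ≤ t) :
    |z * t / (1 - z * t)| ≤ 1 := by
  have : z * t ≤ 0 := mul_nonpos_of_nonpos_of_nonneg hz ht
  rw [abs_div, abs_of_nonpos this, abs_of_pos (by linarith), div_le_one (by linarith)]
  linarith

theorem measurable_mul_div_one_sub (z : ℝ) : Measurable fun t : ℝ => z * t / (1 - z * t) := by
  fun_prop

theorem integrable_pow_mul_div_one_sub (h0 : ∀ᵐ t ∂ρ, 0 ≤ t) {K : ℕ}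
    (hK : Integrable (fun t : ℝ => t ^ K) ρ) {z : ℝ} (hz : z ≤ 0) :
    Integrable (fun t => t ^ K * (z * t / (1 - z * t))) ρ := by
  refine hK.mul_bdd (c := 1) (measurable_mul_div_one_sub z).aestronglyMeasurable ?_
  filter_upwards [h0] with t ht
  exact abs_mul_div_one_sub_le hz ht

theorem integrable_pow_of_le [IsFiniteMeasure ρ] {K p : ℕ} (h : K ≤ p)
    (hp : Integrable (fun t : ℝ => t ^ p) ρ) : Integrable (fun t : ℝ => t ^ K) ρ := by
  refine ((integrable_const (1 : ℝ)).add hp.norm).mono' (by fun_prop) (ae_of_all _ fun t => ?_)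
  simp only [Pi.add_apply, norm_pow]
  rcases le_total ‖t‖ 1 with ht | ht
  · have := pow_le_one₀ (n := K) (norm_nonneg t) ht
    have : 0 ≤ ‖t‖ ^ p := by positivity
    linarith
  · have := pow_le_pow_right₀ ht h
    linarith

/-- Taylor formula at `0⁻` for the moment transform, with integral remainder. -/
theorem psi_eq_sum_add_remainder [IsFiniteMeasure ρ] (h0 : ∀ᵐ t ∂ρ, 0 ≤ t) {K : ℕ}
    (hK : Integrable (fun t : ℝ => t ^ K) ρ) {z : ℝ} (hz : z ≤ 0) :
    psi ρ z = ∑ j ∈ Finset.range K, (∫ t, t ^ (j + 1) ∂ρ) * z ^ (j + 1) +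
      z ^ K * ∫ t, t ^ K * (z * t / (1 - z * t)) ∂ρ := by
  induction K with
  | zero => simp [psi]
  | succ K ih =>
    have hK' := integrable_pow_of_le K.le_succ hK
    rw [ih hK', Finset.sum_range_succ, add_assoc]
    congr 1
    have e : ∫ t, t ^ K * (z * t / (1 - z * t)) ∂ρ =
        z * (∫ t, t ^ (K + 1) ∂ρ) + z * ∫ t, t ^ (K + 1) * (z * t / (1 - z * t)) ∂ρ := by
      rw [← integral_const_mul, ← integral_const_mul, ← integral_add (hK.const_mul z)
        ((integrable_pow_mul_div_one_sub h0 hK hz).const_mul z)]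
      refine integral_congr_ae ?_
      filter_upwards [h0] with t ht
      have : 1 - z * t ≠ 0 := by nlinarith [mul_nonneg (neg_nonneg.2 hz) ht]
      field_simp
      ring
    rw [e]
    ring

theorem tendsto_integral_pow_mul_div_one_sub (h0 : ∀ᵐ t ∂ρ, 0 ≤ t) {K : ℕ}
    (hK : Integrable (fun t : ℝ => t ^ K) ρ) :
    Tendsto (fun z : ℝ => ∫ t, t ^ K * (z * t / (1 - z * t)) ∂ρ) (𝓝[<] 0) (𝓝 0) := by
  suffices h : Tendsto (fun z : ℝ => ∫ t, t ^ K * (z * t / (1 - z * t)) ∂ρ) (𝓝[<] 0)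
      (𝓝 (∫ _, (0 : ℝ) ∂ρ)) by simpa using h
  refine tendsto_integral_filter_of_dominated_convergence (fun t => ‖t ^ K‖) ?_ ?_ hK.norm ?_
  · exact Eventually.of_forall fun z => by fun_prop
  · filter_upwards [self_mem_nhdsWithin] with z hz
    filter_upwards [h0] with t ht
    rw [norm_mul]
    exact mul_le_of_le_one_right (norm_nonneg _) (abs_mul_div_one_sub_le (le_of_lt hz) ht)
  · refine ae_of_all _ fun t => ?_
    have : ContinuousAt (fun z : ℝ => t ^ K * (z * t / (1 - z * t))) 0 := by
      refine ContinuousAt.mul continuousAt_const (ContinuousAt.div ?_ ?_ ?_)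
      · fun_prop
      · fun_prop
      · simp
    have h := this.tendsto
    simp only [zero_mul, zero_div, mul_zero] at h
    exact h.mono_left nhdsWithin_le_nhds

theorem integrable_pow_succ_of_isBigO (h0 : ∀ᵐ t ∂ρ, 0 ≤ t) {K : ℕ}
    (hK : Integrable (fun t : ℝ => t ^ K) ρ) {ζ : ℝ → ℝ}
    (hζ : Tendsto ζ (𝓝[<] 0) (𝓝[<] 0))
    (hO : (fun w => ∫ t, t ^ K * (ζ w * t / (1 - ζ w * t)) ∂ρ) =O[𝓝[<] 0] ζ) :
    Integrable (fun t : ℝ => t ^ (K + 1)) ρ := by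
  obtain ⟨c, hc⟩ := hO.bound
  have key : ∀ n : ℕ, IntegrableOn (fun t : ℝ => t ^ (K + 1)) (Set.Iic (n : ℝ)) ρ ∧
      ∫ t in Set.Iic (n : ℝ), t ^ (K + 1) ∂ρ ≤ 2 * c := by
    intro n
    have hn : ∀ᶠ w in 𝓝[<] (0 : ℝ), -(1 / ((n : ℝ) + 1)) < ζ w :=
      (hζ.mono_right nhdsWithin_le_nhds).eventually
        (lt_mem_nhds (neg_lt_zero.2 (by positivity)))
    have hneg : ∀ᶠ w in 𝓝[<] (0 : ℝ), ζ w < 0 := hζ.eventually self_mem_nhdsWithin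
    obtain ⟨w, hw1, hw2, hw3⟩ := (hn.and (hneg.and hc)).exists
    set z := ζ w
    have hf := (integrable_pow_mul_div_one_sub h0 hK hw2.le).const_mul (2 / z)
    have hfnn : ∀ᵐ t ∂ρ, 0 ≤ 2 / z * (t ^ K * (z * t / (1 - z * t))) := by
      filter_upwards [h0] with t ht
      have : 0 < 1 - z * t := by nlinarith
      have e : 2 / z * (t ^ K * (z * t / (1 - z * t))) = 2 * (t ^ (K + 1) / (1 - z * t)) := by
        have := hw2.ne
        field_simp
        ring
      rw [e]; positivity
    have hle : ∀ᵐ t ∂(ρ.restrict (Set.Iic (n : ℝ))),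
        t ^ (K + 1) ≤ 2 / z * (t ^ K * (z * t / (1 - z * t))) := by
      filter_upwards [ae_restrict_of_ae h0, ae_restrict_mem measurableSet_Iic] with t ht htn
      have htn : t ≤ n := htn
      have h1 : 0 < 1 - z * t := by nlinarith
      have h2 : 1 - z * t ≤ 2 := by
        have h3 : -z * ((n : ℝ) + 1) < 1 := by
          rw [← lt_div_iff₀ (by positivity)]; linarith
        nlinarith
      have e : 2 / z * (t ^ K * (z * t / (1 - z * t))) = t ^ (K + 1) * (2 / (1 - z * t)) := by
        have := hw2.ne
        field_simp
        ring
      rw [e]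
      exact le_mul_of_one_le_right (by positivity) ((one_le_div h1).2 h2)
    have hint : IntegrableOn (fun t : ℝ => t ^ (K + 1)) (Set.Iic (n : ℝ)) ρ := by
      refine hf.restrict.mono' (by fun_prop) ?_
      filter_upwards [ae_restrict_of_ae h0, hle] with t ht h
      rwa [Real.norm_of_nonneg (by positivity)]
    refine ⟨hint, (integral_mono_ae hint hf.restrict hle).trans
      ((setIntegral_le_integral hf hfnn).trans ?_)⟩
    rw [integral_const_mul]
    refine (le_abs_self _).trans ?_
    rw [abs_mul, abs_div, abs_two]
    have hz : 0 < |z| := abs_pos.2 hw2.ne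
    rw [Real.norm_eq_abs, Real.norm_eq_abs] at hw3
    rw [div_mul_eq_mul_div, div_le_iff₀ hz]
    linarith
  refine (aecover_Iic tendsto_natCast_atTop_atTop).integrable_of_integral_bounded_of_nonneg_ae
    (2 * c) (fun n => (key n).1) ?_ (Eventually.of_forall fun n => (key n).2)
  filter_upwards [h0] with t ht
  positivity

theorem psi_mono [IsFiniteMeasure ρ] (h0 : ∀ᵐ t ∂ρ, 0 ≤ t) {x y : ℝ} (hxy : x ≤ y)
    (hy : y ≤ 0) : psi ρ x ≤ psi ρ y := by
  have hi : ∀ z ≤ 0, Integrable (fun t => z * t / (1 - z * t)) ρ := fun z hz => by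
    simpa using integrable_pow_mul_div_one_sub (K := 0) h0 (by simp) hz
  refine integral_mono_ae (hi x (hxy.trans hy)) (hi y hy) ?_
  filter_upwards [h0] with t ht
  have h1 : x * t ≤ y * t := mul_le_mul_of_nonneg_right hxy ht
  have h2 : y * t ≤ 0 := mul_nonpos_of_nonpos_of_nonneg hy ht
  rw [div_le_div_iff₀ (by linarith) (by linarith)]
  nlinarith

theorem eq_dirac_zero_of_ae [IsProbabilityMeasure ρ] (h : ∀ᵐ t ∂ρ, t = 0) :
    ρ = Measure.dirac 0 := by
  have : Measure.map (fun t : ℝ => t) ρ = Measure.map (fun _ => (0 : ℝ)) ρ := Measure.map_congr h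
  rw [Measure.map_id', Measure.map_const] at this
  simpa using this

theorem psi_neg [IsProbabilityMeasure ρ] (h0 : ∀ᵐ t ∂ρ, 0 ≤ t) (hρ : ρ ≠ Measure.dirac 0)
    {z : ℝ} (hz : z < 0) : psi ρ z < 0 := by
  have hi : Integrable (fun t => z * t / (1 - z * t)) ρ := by
    simpa using integrable_pow_mul_div_one_sub (K := 0) h0 (by simp) hz.le
  have hnn : 0 ≤ᵐ[ρ] fun t => -(z * t / (1 - z * t)) := by
    filter_upwards [h0] with t ht
    have : z * t ≤ 0 := mul_nonpos_of_nonpos_of_nonneg hz.le ht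
    exact neg_nonneg.2 (div_nonpos_of_nonpos_of_nonneg this (by linarith))
  have h1 : 0 ≤ ∫ t, -(z * t / (1 - z * t)) ∂ρ := integral_nonneg_of_ae hnn
  rcases h1.eq_or_lt with h | h
  · refine absurd (eq_dirac_zero_of_ae ?_) hρ
    filter_upwards [(integral_eq_zero_iff_of_nonneg_ae hnn hi.neg).1 h.symm, h0] with t ht ht0
    have h2 : 1 - z * t ≠ 0 := by nlinarith
    have h3 : z * t = 0 := by
      simp only [Pi.zero_apply, neg_eq_zero, div_eq_zero_iff] at ht
      exact ht.resolve_right h2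
    exact (mul_eq_zero.1 h3).resolve_left hz.ne
  · rw [integral_neg] at h
    exact neg_pos.1 h

theorem integral_pos_of_ne_dirac [IsProbabilityMeasure ρ] (h0 : ∀ᵐ t ∂ρ, 0 ≤ t)
    (hρ : ρ ≠ Measure.dirac 0) (hi : Integrable (fun t : ℝ => t) ρ) : 0 < ∫ t, t ∂ρ := by
  rcases (integral_nonneg_of_ae h0).eq_or_lt with h | h
  · exact absurd (eq_dirac_zero_of_ae ((integral_eq_zero_iff_of_nonneg_ae h0 hi).1 h.symm)) hρ
  · exact h

end MomentTransform
section Inversion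
open Asymptotics Polynomial

/-- The degree `p` Taylor polynomial at `0` of the moment transform. -/
noncomputable def momentPoly (ρ : Measure ℝ) (p : ℕ) : ℝ[X] :=
  ∑ j ∈ Finset.range p, C (∫ t, t ^ (j + 1) ∂ρ) * X ^ (j + 1)

variable {ρ : Measure ℝ}

theorem eval_momentPoly (p : ℕ) (z : ℝ) : (momentPoly ρ p).eval z =
    ∑ j ∈ Finset.range p, (∫ t, t ^ (j + 1) ∂ρ) * z ^ (j + 1) := by
  simp [momentPoly, eval_finsetSum]

theorem momentPoly_succ (p : ℕ) : momentPoly ρ (p + 1) = C (∫ t, t ∂ρ) * X +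
    X ^ 2 * ∑ j ∈ Finset.range p, C (∫ t, t ^ (j + 2) ∂ρ) * X ^ j := by
  rw [momentPoly, Finset.sum_range_succ', Finset.mul_sum, add_comm]
  simp only [zero_add, pow_one]
  congr 1
  exact Finset.sum_congr rfl fun j _ => by ring

theorem expandsLeft_psi [IsFiniteMeasure ρ] (h0 : ∀ᵐ t ∂ρ, 0 ≤ t) {p : ℕ}
    (hp : Integrable (fun t : ℝ => t ^ p) ρ) : ExpandsLeft (psi ρ) (momentPoly ρ p) p := by
  have h := (isBigO_refl (fun z : ℝ => z ^ p) (𝓝[<] 0)).mul_isLittleO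
    ((isLittleO_one_iff ℝ).2 (tendsto_integral_pow_mul_div_one_sub h0 hp))
  refine h.congr' ?_ (by simp)
  filter_upwards [self_mem_nhdsWithin] with z hz
  rw [psi_eq_sum_add_remainder h0 hp (le_of_lt hz), eval_momentPoly]
  ring

section RightInverse
variable [IsProbabilityMeasure ρ] {χ : ℝ → ℝ}

theorem tendsto_of_psi_eq (h0 : ∀ᵐ t ∂ρ, 0 ≤ t) (hρ : ρ ≠ Measure.dirac 0)
    (hχ : ∀ᶠ w in 𝓝[<] 0, χ w < 0 ∧ psi ρ (χ w) = w) : Tendsto χ (𝓝[<] 0) (𝓝[<] 0) := by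
  refine tendsto_nhdsWithin_iff.2 ⟨tendsto_order.2 ⟨fun a ha => ?_, fun a ha => ?_⟩,
    hχ.mono fun w hw => hw.1⟩
  · filter_upwards [hχ, Ioo_mem_nhdsLT (psi_neg h0 hρ ha)] with w hw hwa
    by_contra! hle
    have := psi_mono h0 hle ha.le
    rw [hw.2] at this
    exact absurd hwa.1 (not_lt.2 this)
  · filter_upwards [hχ] with w hw using hw.1.trans ha

theorem isBigO_of_psi_eq (h0 : ∀ᵐ t ∂ρ, 0 ≤ t) (hρ : ρ ≠ Measure.dirac 0)
    (hi : Integrable (fun t : ℝ => t) ρ)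
    (hχ : ∀ᶠ w in 𝓝[<] 0, χ w < 0 ∧ psi ρ (χ w) = w) : χ =O[𝓝[<] 0] fun w => w := by
  have hm := integral_pos_of_ne_dirac h0 hρ hi
  have h1 : (fun z => psi ρ z - (∫ t, t ∂ρ) * z) =o[𝓝[<] 0] fun z => (∫ t, t ∂ρ) * z := by
    have := expandsLeft_psi h0 (p := 1) (by simpa using hi)
    simp only [ExpandsLeft, momentPoly_succ] at this
    simp only [Finset.range_zero, Finset.sum_empty, mul_zero, add_zero, eval_mul, eval_C,
      eval_X, pow_one] at this
    exact this.trans_isBigO (isBigO_self_const_mul hm.ne' _ _)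
  have h2 : (fun z => z) =O[𝓝[<] 0] psi ρ := by
    refine (isBigO_self_const_mul hm.ne' _ _).trans (h1.right_isBigO_add.congr_right fun z => ?_)
    ring
  refine (h2.comp_tendsto (tendsto_of_psi_eq h0 hρ hχ)).congr' EventuallyEq.rfl ?_
  filter_upwards [hχ] with w hw using hw.2

theorem momentPoly_eval_sub_isLittleO (h0 : ∀ᵐ t ∂ρ, 0 ≤ t) {p : ℕ}
    (hp : Integrable (fun t : ℝ => t ^ p) ρ) (hlim : Tendsto χ (𝓝[<] 0) (𝓝[<] 0))
    (hO : χ =O[𝓝[<] 0] fun w => w) (hχ : ∀ᶠ w in 𝓝[<] 0, psi ρ (χ w) = w) :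
    (fun w => (momentPoly ρ p).eval (χ w) - w) =o[𝓝[<] 0] fun w => w ^ p := by
  have h := ((expandsLeft_psi h0 hp).comp_tendsto hlim).trans_isBigO (hO.pow p)
  refine h.neg_left.congr' ?_ EventuallyEq.rfl
  filter_upwards [hχ] with w hw
  simp only [Function.comp, hw]
  ring

/-- The moments of `ρ` are controlled by the expansion of a right inverse of its moment
transform. -/
theorem integrable_pow_of_psi_eq (h0 : ∀ᵐ t ∂ρ, 0 ≤ t) {g : ℝ[X]} {p : ℕ} (hp : 0 < p)
    (hg : g.coeff 0 ≠ 0) (hχ : ∀ᶠ w in 𝓝[<] 0, χ w < 0 ∧ psi ρ (χ w) = w)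
    (hexp : ExpandsLeft χ (X * g) p) :
    Integrable (fun t : ℝ => t ^ p) ρ ∧
      ∀ k ≤ p, ((momentPoly ρ p).comp (X * g) - X).coeff k = 0 := by
  have hO : χ =O[𝓝[<] 0] fun w => w := by
    simpa using (hexp.mono (show 1 ≤ p from hp)).isBigO_pow (by
      intro k hk
      obtain rfl : k = 0 := by omega
      simp)
  have hlim : Tendsto χ (𝓝[<] 0) (𝓝[<] 0) :=
    tendsto_nhdsWithin_iff.2 ⟨hO.trans_tendsto tendsto_id_nhdsLT_zero, hχ.mono fun w hw => hw.1⟩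
  have hO' : (fun w => w) =O[𝓝[<] 0] χ := by
    have h1 : ExpandsLeft (fun w => χ w / w) g 0 :=
      ExpandsLeft.div_self (hexp.mono (show 1 ≤ p from hp))
    have h2 : Tendsto (fun w => χ w / w) (𝓝[<] 0) (𝓝 (g.coeff 0)) := by
      have h3 : Tendsto (fun w => χ w / w - g.eval w) (𝓝[<] 0) (𝓝 0) := by
        simpa [ExpandsLeft] using h1
      have := h3.add ((g.continuous.tendsto 0).comp tendsto_id_nhdsLT_zero)
      simpa [coeff_zero_eq_eval_zero] using this
    have h3 := ((h2.inv₀ hg).isBigO_one ℝ).mul (isBigO_refl χ (𝓝[<] 0))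
    simp only [one_mul] at h3
    refine h3.congr' ?_ EventuallyEq.rfl
    filter_upwards [hχ] with w hw
    have := hw.1.ne
    field_simp
  have hint : ∀ K ≤ p, Integrable (fun t : ℝ => t ^ K) ρ := by
    intro K
    induction K with
    | zero => intro _; simp
    | succ K ih =>
      intro hK
      have hi := ih (by omega)
      have hsmall := momentPoly_eval_sub_isLittleO h0 hi hlim hO (hχ.mono fun w hw => hw.2)
      have hE : ExpandsLeft (fun w => (momentPoly ρ K).eval (χ w) - w)
          ((momentPoly ρ K).comp (X * g) - X) (K + 1) := by
        simpa using ((hexp.mono hK).polynomial_comp (momentPoly ρ K)).sub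
          (ExpandsLeft.of_polynomial X (K + 1))
      have hbig : (fun w => (momentPoly ρ K).eval (χ w) - w) =O[𝓝[<] 0]
          fun w => w ^ (K + 1) :=
        hE.isBigO_pow fun k hk => (hE.mono K.le_succ).coeff_eq_zero hsmall k (by omega)
      refine integrable_pow_succ_of_isBigO h0 hi hlim ?_
      have h4 := ((isBigO_refl (fun w => (χ w ^ K)⁻¹) (𝓝[<] 0)).mul
        (hbig.trans (hO'.pow (K + 1)))).neg_left
      refine h4.congr' ?_ ?_
      · filter_upwards [hχ] with w hw
        have h5 := psi_eq_sum_add_remainder h0 hi hw.1.le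
        rw [hw.2, ← eval_momentPoly] at h5
        have : χ w ^ K ≠ 0 := pow_ne_zero _ hw.1.ne
        rw [← mul_neg, inv_mul_eq_iff_eq_mul₀ this]
        linarith
      · filter_upwards [hχ] with w hw
        have : χ w ≠ 0 := hw.1.ne
        field_simp
        ring
  refine ⟨hint p le_rfl, ?_⟩
  have hE : ExpandsLeft (fun w => (momentPoly ρ p).eval (χ w) - w)
      ((momentPoly ρ p).comp (X * g) - X) p := by
    simpa using (hexp.polynomial_comp (momentPoly ρ p)).sub (ExpandsLeft.of_polynomial X p)
  exact hE.coeff_eq_zero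
    (momentPoly_eval_sub_isLittleO h0 (hint p le_rfl) hlim hO (hχ.mono fun w hw => hw.2))

/-- All right inverses of `psi ρ` share the same expansion at `0⁻`. -/
theorem exists_expandsLeft_of_psi_eq (h0 : ∀ᵐ t ∂ρ, 0 ≤ t) (hρ : ρ ≠ Measure.dirac 0) {p : ℕ}
    (hp : 0 < p) (hi : Integrable (fun t : ℝ => t ^ p) ρ) :
    ∃ a : ℝ[X], ∀ χ : ℝ → ℝ, (∀ᶠ w in 𝓝[<] 0, χ w < 0 ∧ psi ρ (χ w) = w) →
      ExpandsLeft χ (X * a) p := by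
  have hi1 : Integrable (fun t : ℝ => t) ρ := by
    simpa using integrable_pow_of_le (show 1 ≤ p from hp) hi
  obtain ⟨k, rfl⟩ : ∃ k, p = k + 1 := ⟨p - 1, by omega⟩
  obtain ⟨a, ha⟩ := exists_expandsLeft_of_eval_sub_isLittleO
    (∑ j ∈ Finset.range k, C (∫ t, t ^ (j + 2) ∂ρ) * X ^ j)
    (integral_pos_of_ne_dirac h0 hρ hi1).ne' (k + 1)
  refine ⟨a, fun χ hχ => ?_⟩
  have hO := isBigO_of_psi_eq h0 hρ hi1 hχ
  refine ha χ hO ?_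
  rw [← momentPoly_succ]
  exact momentPoly_eval_sub_isLittleO h0 hi (tendsto_of_psi_eq h0 hρ hχ) hO
    (hχ.mono fun w hw => hw.2)

end RightInverse

theorem coeff_zero_of_comp_eq {a : ℝ[X]} {p : ℕ}
    (h : ∀ k ≤ p + 1, ((momentPoly ρ (p + 1)).comp (X * a) - X).coeff k = 0) :
    (∫ t, t ∂ρ) * a.coeff 0 = 1 := by
  have h1 := h 1 (by omega)
  rw [momentPoly_succ] at h1
  simp only [add_comp, mul_comp, C_comp, X_comp, pow_comp, mul_pow, coeff_sub, coeff_add,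
    coeff_X_one] at h1
  rw [coeff_C_mul, coeff_X_mul, mul_assoc, coeff_X_pow_mul', if_neg (by omega)] at h1
  linarith

theorem coeff_one_of_comp_eq {a : ℝ[X]} {p : ℕ}
    (h : ∀ k ≤ p + 2, ((momentPoly ρ (p + 2)).comp (X * a) - X).coeff k = 0) :
    (∫ t, t ∂ρ) * a.coeff 1 + (∫ t, t ^ 2 ∂ρ) * a.coeff 0 ^ 2 = 0 := by
  have h1 := h 2 (by omega)
  rw [momentPoly_succ] at h1
  simp only [add_comp, mul_comp, C_comp, X_comp, pow_comp, mul_pow, coeff_sub, coeff_add,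
    coeff_X] at h1
  rw [coeff_C_mul, coeff_X_mul, mul_assoc, coeff_X_pow_mul', if_pos le_rfl, if_neg (by omega)]
    at h1
  simp only [tsub_self, mul_coeff_zero, Finset.sum_range_succ', add_comp, coeff_add] at h1
  simp [coeff_zero_eq_eval_zero, eval_finsetSum] at h1 ⊢
  linarith

end Inversion

section FreePower
open Polynomial

theorem ae_nonneg_of_measure_Iio_eq_zero {ρ : Measure ℝ} (h : ρ (Set.Iio 0) = 0) :
    ∀ᵐ t ∂ρ, 0 ≤ t := by
  rw [ae_iff]
  convert! h using 2
  ext t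
  simp

theorem measure_singleton_zero_toReal_lt_one {ρ : Measure ℝ} [IsProbabilityMeasure ρ]
    (hρ : ρ ≠ Measure.dirac 0) : (ρ {0}).toReal < 1 := by
  refine lt_of_le_of_ne (ENNReal.toReal_le_of_le_ofReal zero_le_one (by simpa using prob_le_one))
    fun h => hρ (eq_dirac_zero_of_ae ?_)
  have h1 : ρ {0} = 1 := by
    rwa [ENNReal.toReal_eq_one_iff] at h
  exact (prob_compl_eq_zero_iff (measurableSet_singleton (0 : ℝ))).2 h1

theorem RealizesFreePower.exists_eventually {μ ν : Measure ℝ} [IsProbabilityMeasure μ]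
    (hμ : μ ≠ Measure.dirac 0) {n : ℕ} (h : RealizesFreePower μ ν n) :
    ∃ χ : ℝ → ℝ, (∀ᶠ w in 𝓝[<] 0, χ w < 0 ∧ psi μ (χ w) = w) ∧
      ∀ᶠ w in 𝓝[<] 0, psi ν (((w + 1) / w) ^ (n - 1) * χ w ^ n) = w := by
  obtain ⟨χ, h1, h2⟩ := h
  have hI : Set.Ioo ((μ {0}).toReal - 1) 0 ∈ 𝓝[<] (0 : ℝ) :=
    Ioo_mem_nhdsLT (by linarith [measure_singleton_zero_toReal_lt_one hμ])
  exact ⟨χ, mem_of_superset hI h1, mem_of_superset hI h2⟩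

theorem momentPoly_comp_freePower {ν : Measure ℝ} [IsProbabilityMeasure ν]
    (h0 : ∀ᵐ t ∂ν, 0 ≤ t) {a : ℝ[X]} (ha : a.coeff 0 ≠ 0) {p : ℕ} (hp : 0 < p) {χ : ℝ → ℝ}
    (hneg : ∀ᶠ w in 𝓝[<] 0, χ w < 0) (hχ : ExpandsLeft χ (X * a) p) (n : ℕ)
    (hν : ∀ᶠ w in 𝓝[<] 0, psi ν (((w + 1) / w) ^ n * χ w ^ (n + 1)) = w) :
    ∀ k ≤ p, ((momentPoly ν p).comp (X * ((1 + X) ^ n * a ^ (n + 1))) - X).coeff k = 0 := by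
  obtain ⟨k, rfl⟩ : ∃ k, p = k + 1 := ⟨p - 1, by omega⟩
  have hz : (fun w => w * ((1 + X : ℝ[X]) ^ n).eval w * (χ w / w) ^ (n + 1)) =ᶠ[𝓝[<] 0]
      fun w => ((w + 1) / w) ^ n * χ w ^ (n + 1) := by
    filter_upwards [self_mem_nhdsWithin] with w hw
    have : w ≠ 0 := ne_of_lt hw
    simp only [eval_pow, eval_add, eval_one, eval_X, div_pow]
    field_simp
    ring
  refine (integrable_pow_of_psi_eq h0 hp (g := (1 + X) ^ n * a ^ (n + 1)) ?_
    (χ := fun w => ((w + 1) / w) ^ n * χ w ^ (n + 1)) ?_ ?_).2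
  · simpa [coeff_zero_eq_eval_zero] using ha
  · filter_upwards [hz, hν, hneg, Ioo_mem_nhdsLT (show (-1 : ℝ) < 0 by norm_num)]
      with w hw hw' hχw hI
    refine ⟨?_, hw'⟩
    rw [← hw]
    have h1 : 0 < 1 + w := by linarith [hI.1]
    have h2 : 0 < χ w / w := div_pos_of_neg_of_neg hχw hI.2
    simp only [eval_pow, eval_add, eval_one, eval_X]
    exact mul_neg_of_neg_of_pos (mul_neg_of_neg_of_pos hI.2 (by positivity)) (by positivity)
  · refine ExpandsLeft.congr' ?_ hz
    simp only [mul_assoc]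
    exact ((ExpandsLeft.of_polynomial _ _).mul (hχ.div_self.pow (n + 1))).X_mul

theorem mul_moment_eq_coeff {ν : Measure ℝ} {a : ℝ[X]} {m : ℝ} (hm : m ≠ 0)
    {p : ℕ} (hp : 0 < p) {q : PowerSeries ℝ}
    (hq : PowerSeries.C m * (1 + PowerSeries.X) * (a : PowerSeries ℝ) * q = 1) (n : ℕ)
    (h : ∀ k ≤ p,
      ((momentPoly ν p).comp (X * ((1 + X) ^ n * a ^ (n + 1))) - X).coeff k = 0) :
    p * ((∫ t, t ^ p ∂ν) / m ^ (p * (n + 1))) =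
      PowerSeries.coeff (p - 1) ((1 + PowerSeries.X) ^ p * q ^ (p * (n + 1))) := by
  have hgh : (((1 + X) ^ n * a ^ (n + 1) : ℝ[X]) : PowerSeries ℝ) *
      (PowerSeries.C (m ^ (n + 1)) * (1 + PowerSeries.X) * q ^ (n + 1)) = 1 := by
    have := congrArg (· ^ (n + 1)) hq
    simp only [one_pow] at this
    refine Eq.trans ?_ this
    rw [map_pow]
    push_cast
    generalize (1 + PowerSeries.X : PowerSeries ℝ) = Y
    ring
  have := lagrange_inversion_of_coeff_eq hgh (fun j => ∫ t, t ^ j ∂ν) hp (fun k hk => by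
    have := h k hk
    rw [coeff_sub, sub_eq_zero, momentPoly, ← coeff_coe, ← coeff_coe] at this
    rw [coe_X] at this
    rw [← this]
    congr 1
    simp only [Polynomial.sum_comp, mul_comp, C_comp, pow_comp, X_comp]
    rw [← Polynomial.coeToPowerSeries.ringHom_apply (φ := ∑ x ∈ Finset.range p, _), map_sum]
    simp)
  have e : (PowerSeries.C (m ^ (n + 1)) * (1 + PowerSeries.X) * q ^ (n + 1)) ^ p =
      PowerSeries.C (m ^ (p * (n + 1))) * ((1 + PowerSeries.X) ^ p * q ^ (p * (n + 1))) := by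
    simp only [map_pow]
    generalize (1 + PowerSeries.X : PowerSeries ℝ) = Y
    ring
  rw [e, PowerSeries.coeff_C_mul] at this
  have hm' : m ^ (p * (n + 1)) ≠ 0 := pow_ne_zero _ hm
  field_simp
  linarith

end FreePower

/-- Asymptotics of integer moments of free multiplicative convolution powers:
if `μ` is a non-Dirac probability measure on `[0,∞)` with finite `p`-th moment, then
`n^{1-p} m_p(μ^{⊠n}) / m₁(μ)^{pn} → (ηp)^{p-1}/p!` where `η = Var(μ)/m₁(μ)²`. -/
theorem moment_asymptotics_free_power
    (μ : Measure ℝ) [IsProbabilityMeasure μ] (hsupp : μ (Set.Iio 0) = 0)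
    (hnd : ∀ a : ℝ, μ ≠ Measure.dirac a)
    (p : ℕ) (hp : 0 < p) (hmp : Integrable (fun t : ℝ => t ^ p) μ)
    (ν : ℕ → Measure ℝ) (hprob : ∀ n, IsProbabilityMeasure (ν n))
    (hνsupp : ∀ n, (ν n) (Set.Iio 0) = 0)
    (hν : ∀ n, 1 ≤ n → RealizesFreePower μ (ν n) n) :
    Tendsto (fun n : ℕ => (n : ℝ) ^ ((1 : ℝ) - (p : ℝ)) *
        ((∫ t, t ^ p ∂(ν n)) / (∫ t, t ∂μ) ^ (p * n))) atTop
      (𝓝 ((((((∫ t, t ^ 2 ∂μ) - (∫ t, t ∂μ) ^ 2) / (∫ t, t ∂μ) ^ 2) * (p : ℝ)) ^ (p - 1)) /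
        (Nat.factorial p : ℝ))) := by
  have h0 := ae_nonneg_of_measure_Iio_eq_zero hsupp
  have hm := integral_pos_of_ne_dirac h0 (hnd 0)
    (by simpa using integrable_pow_of_le (show 1 ≤ p from hp) hmp)
  obtain ⟨a, ha⟩ := exists_expandsLeft_of_psi_eq h0 (hnd 0) hp hmp
  have hcomp : ∀ k ≤ p, ((momentPoly μ p).comp (Polynomial.X * a) - Polynomial.X).coeff k = 0 := by
    obtain ⟨χ, hχ, -⟩ := (hν 1 le_rfl).exists_eventually (hnd 0)
    have hE : ExpandsLeft (fun w => (momentPoly μ p).eval (χ w) - w)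
        ((momentPoly μ p).comp (Polynomial.X * a) - Polynomial.X) p := by
      simpa using ((ha χ hχ).polynomial_comp (momentPoly μ p)).sub
        (ExpandsLeft.of_polynomial Polynomial.X p)
    exact hE.coeff_eq_zero (momentPoly_eval_sub_isLittleO h0 hmp (tendsto_of_psi_eq h0 (hnd 0) hχ)
      (isBigO_of_psi_eq h0 (hnd 0)
        (by simpa using integrable_pow_of_le (show 1 ≤ p from hp) hmp) hχ)
      (hχ.mono fun w hw => hw.2))
  set m := ∫ t, t ∂μ with hmdef
  have ha0 : m * a.coeff 0 = 1 := by
    obtain ⟨k, rfl⟩ : ∃ k, p = k + 1 := ⟨p - 1, by omega⟩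
    exact coeff_zero_of_comp_eq hcomp
  set b : PowerSeries ℝ := PowerSeries.C m * (1 + PowerSeries.X) * (a : PowerSeries ℝ) with hb
  have hb0 : PowerSeries.constantCoeff b = 1 := by simp [hb, ha0]
  have hbq : b * b⁻¹ = 1 := PowerSeries.mul_inv_cancel b (by rw [hb0]; exact one_ne_zero)
  have hq0 : PowerSeries.constantCoeff b⁻¹ = 1 := by simp [hb0]
  have hq1 : PowerSeries.coeff 1 b⁻¹ ^ (p - 1) =
      (((∫ t, t ^ 2 ∂μ) - m ^ 2) / m ^ 2) ^ (p - 1) := by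
    rcases Nat.lt_or_ge p 2 with hp2 | hp2
    · rw [show p - 1 = 0 by omega, pow_zero, pow_zero]
    · congr 1
      obtain ⟨k, rfl⟩ : ∃ k, p = k + 2 := ⟨p - 2, by omega⟩
      have ha1 := coeff_one_of_comp_eq hcomp
      have hb1 : PowerSeries.coeff 1 b = m * a.coeff 1 + m * a.coeff 0 := by
        have := PowerSeries.coeff_succ_X_mul 0 (a : PowerSeries ℝ)
        rw [hb, mul_assoc, PowerSeries.coeff_C_mul, add_mul, one_mul, map_add]
        simp [this]
        ring
      have h1 := congrArg (PowerSeries.coeff 1) hbq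
      rw [PowerSeries.coeff_mul, Finset.Nat.sum_antidiagonal_eq_sum_range_succ_mk] at h1
      simp only [Finset.sum_range_succ, Finset.range_zero, Finset.sum_empty, zero_add,
        PowerSeries.coeff_zero_eq_constantCoeff, hb0, hq0, hb1, PowerSeries.coeff_one,
        Nat.sub_zero, Nat.sub_self, one_ne_zero, if_false, one_mul, mul_one] at h1
      have ha0' : a.coeff 0 = 1 / m := by field_simp; linarith
      rw [← hmdef, ha0'] at ha1
      rw [ha0'] at h1
      have hm' := hm.ne'
      field_simp at ha1 h1 ⊢
      nlinarith
  have hlim := ((tendsto_coeff_mul_pow_div ((1 + PowerSeries.X) ^ p) b⁻¹ (by simp) hq0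
    (p - 1)).comp (tendsto_id.const_mul_atTop' hp)).mul_const ((p : ℝ) ^ (p - 1) / p)
  rw [hq1] at hlim
  have hp' : (p : ℝ) ≠ 0 := by positivity
  convert! hlim.congr' ?_ using 2
  · rw [mul_pow, ← Nat.mul_factorial_pred hp.ne']
    have := Nat.factorial_ne_zero (p - 1)
    push_cast
    field_simp
  · filter_upwards [eventually_ge_atTop 1] with n hn
    have := hprob n
    obtain ⟨χ, hχ, hχν⟩ := (hν n hn).exists_eventually (hnd 0)
    obtain ⟨k, rfl⟩ : ∃ k, n = k + 1 := ⟨n - 1, by omega⟩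
    have key := mul_moment_eq_coeff hm.ne' hp hbq k (momentPoly_comp_freePower
      (ae_nonneg_of_measure_Iio_eq_zero (hνsupp (k + 1))) (right_ne_zero_of_mul_eq_one ha0) hp
      (hχ.mono fun w hw => hw.1) (ha χ hχ) k hχν)
    have hpow : ((k + 1 : ℕ) : ℝ) ^ ((1 : ℝ) - (p : ℝ)) = (((k + 1 : ℕ) : ℝ) ^ (p - 1))⁻¹ := by
      rw [← Real.rpow_natCast, ← Real.rpow_neg (by positivity), Nat.cast_sub hp]
      congr 1
      push_cast
      ring
    simp only [Function.comp, id]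
    rw [← key, hpow, Nat.cast_mul, mul_pow]
    have hk : (((k + 1 : ℕ) : ℝ)) ≠ 0 := by positivity
    field_simp
end

section
/- Let μ be a Borel probability measure on [0,∞) with δ := μ({0}) < 1, let γ ∈ (0,1) with m_γ(μ) < +∞, and let χ : (δ−1,0) → (−∞,0) satisfy ψ_μ(χ(z)) = z for all z ∈ (δ−1,0). Then ∫_{[0,∞)} x^γ dμ(x) = (sin(πγ)/(πγ)) · ∫_0^{1−δ} (−χ(−t))^{−γ} dt; equivalently, with S_μ(z) = ((z+1)/z) χ(z), the right-hand side equals (sin(πγ)/(πγ)) ∫_0^{1−δ} ((1−t)/(t · S_μ(−t)))^γ dt. -/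
open MeasureTheory Filter Topology Real

theorem lintegral_rpow_mul_exp_neg_mul_Ioi {a r : ℝ} (ha : 0 < a) (hr : 0 < r) :
    ∫⁻ t in Set.Ioi (0 : ℝ), ENNReal.ofReal (t ^ (a - 1) * exp (-(r * t))) =
      ENNReal.ofReal ((1 / r) ^ a * Gamma a) := by
  have h := Real.integral_rpow_mul_exp_neg_mul_Ioi ha hr
  have hpos : 0 < (1 / r) ^ a * Gamma a :=
    mul_pos (rpow_pos_of_pos (by positivity) _) (Gamma_pos_of_pos ha)
  rw [← h, ofReal_integral_eq_lintegral_ofReal]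
  · exact Integrable.of_integral_ne_zero (by rw [h]; exact hpos.ne')
  · filter_upwards [ae_restrict_mem measurableSet_Ioi] with t (ht : 0 < t)
    positivity

theorem lintegral_exp_neg_mul_Ioi {r : ℝ} (hr : 0 < r) :
    ∫⁻ t in Set.Ioi (0 : ℝ), ENNReal.ofReal (exp (-(r * t))) = ENNReal.ofReal r⁻¹ := by
  simpa using lintegral_rpow_mul_exp_neg_mul_Ioi one_pos hr

theorem lintegral_rpow_neg_mul_div_one_add_mul_Ioi {γ x : ℝ} (hγ : γ ∈ Set.Ioo (0 : ℝ) 1)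
    (hx : 0 < x) :
    ∫⁻ u in Set.Ioi (0 : ℝ), ENNReal.ofReal (u ^ (-γ) * (x / (1 + u * x))) =
      ENNReal.ofReal (x ^ γ * (π / sin (π * γ))) := by
  have h1γ : 0 < 1 - γ := sub_pos.2 hγ.2
  calc
    _ = ∫⁻ u in Set.Ioi (0 : ℝ), ∫⁻ w in Set.Ioi (0 : ℝ),
          ENNReal.ofReal (u ^ (-γ) * x * exp (-((1 + u * x) * w))) := by
        refine setLIntegral_congr_fun measurableSet_Ioi fun u (hu : 0 < u) => ?_
        have : 0 < 1 + u * x := by positivity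
        have hc : 0 ≤ u ^ (-γ) * x := by positivity
        simp_rw [ENNReal.ofReal_mul hc]
        rw [lintegral_const_mul _ (by fun_prop), lintegral_exp_neg_mul_Ioi this,
          ← ENNReal.ofReal_mul hc]
        congr 1
        ring
    _ = ∫⁻ w in Set.Ioi (0 : ℝ), ∫⁻ u in Set.Ioi (0 : ℝ),
          ENNReal.ofReal (u ^ (-γ) * x * exp (-((1 + u * x) * w))) :=
        lintegral_lintegral_swap (by fun_prop)
    _ = ∫⁻ w in Set.Ioi (0 : ℝ),
          ENNReal.ofReal (x ^ γ * Gamma (1 - γ) * (w ^ (γ - 1) * exp (-(1 * w)))) := by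
        refine setLIntegral_congr_fun measurableSet_Ioi fun w (hw : 0 < w) => ?_
        have hc : 0 ≤ x * exp (-w) := by positivity
        have key : ∀ u : ℝ, ENNReal.ofReal (u ^ (-γ) * x * exp (-((1 + u * x) * w))) =
            ENNReal.ofReal (x * exp (-w)) *
              ENNReal.ofReal (u ^ (1 - γ - 1) * exp (-((x * w) * u))) := by
          intro u
          rw [← ENNReal.ofReal_mul hc, show -((1 + u * x) * w) = -w + -((x * w) * u) by ring,
            exp_add, show 1 - γ - 1 = -γ by ring]
          congr 1
          ring
        simp_rw [key]
        rw [lintegral_const_mul _ (by fun_prop),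
          lintegral_rpow_mul_exp_neg_mul_Ioi h1γ (by positivity), ← ENNReal.ofReal_mul hc]
        congr 1
        rw [one_div, inv_rpow (by positivity), ← rpow_neg (by positivity),
          mul_rpow hx.le hw.le, neg_sub, one_mul]
        have : x ^ γ = x * x ^ (γ - 1) := by
          rw [rpow_sub_one hx.ne']
          field_simp
        rw [this]
        ring
    _ = _ := by
        have hc : 0 ≤ x ^ γ * Gamma (1 - γ) :=
          mul_nonneg (by positivity) (Gamma_pos_of_pos h1γ).le
        simp_rw [ENNReal.ofReal_mul hc]
        rw [lintegral_const_mul _ (by fun_prop),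
          lintegral_rpow_mul_exp_neg_mul_Ioi hγ.1 one_pos, ← ENNReal.ofReal_mul hc,
          ← Real.Gamma_mul_Gamma_one_sub]
        congr 1
        simp only [div_one, one_rpow]
        ring

theorem lintegral_mul_rpow_neg_sub_one_Ioi {γ s : ℝ} (hγ : 0 < γ) (hs : 0 < s) :
    ∫⁻ u in Set.Ioi s, ENNReal.ofReal (γ * u ^ (-γ - 1)) = ENNReal.ofReal (s ^ (-γ)) := by
  have ha : -γ - 1 < -1 := by linarith
  rw [← ofReal_integral_eq_lintegral_ofReal]
  · rw [integral_const_mul, integral_Ioi_rpow_of_lt ha hs, sub_add_cancel]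
    congr 1
    field_simp
  · exact (integrableOn_Ioi_rpow_of_lt ha hs).const_mul γ
  · filter_upwards [ae_restrict_mem measurableSet_Ioi] with t (ht : s < t)
    have := hs.trans ht
    positivity

theorem neg_psi_neg (μ : Measure ℝ) (u : ℝ) :
    -psi μ (-u) = ∫ x, u * x / (1 + u * x) ∂μ := by
  rw [psi, ← integral_neg]
  congr 1
  ext x
  rw [neg_mul, sub_neg_eq_add, neg_div, neg_neg]

theorem ae_nonneg_of_measure_Iio_eq_zero_s9 {μ : Measure ℝ} (hsupp : μ (Set.Iio 0) = 0) :
    ∀ᵐ x ∂μ, 0 ≤ x := by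
  rw [ae_iff]
  simpa [Set.Iio] using hsupp

theorem mul_div_one_add_mul_mem_Icc {u x : ℝ} (hu : 0 < u) (hx : 0 ≤ x) :
    u * x / (1 + u * x) ∈ Set.Icc (0 : ℝ) 1 := by
  have : 0 ≤ u * x := by positivity
  exact ⟨by positivity, div_le_one_of_le₀ (by linarith) (by linarith)⟩

section

variable {μ : Measure ℝ} [IsProbabilityMeasure μ]

theorem integrable_mul_div_one_add_mul (hsupp : μ (Set.Iio 0) = 0) {u : ℝ} (hu : 0 < u) :
    Integrable (fun x : ℝ => u * x / (1 + u * x)) μ := by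
  refine Integrable.of_bound (C := 1) (Measurable.aestronglyMeasurable (by fun_prop)) ?_
  filter_upwards [ae_nonneg_of_measure_Iio_eq_zero_s9 hsupp] with x hx
  have h := mul_div_one_add_mul_mem_Icc hu hx
  rw [norm_eq_abs, abs_of_nonneg h.1]
  exact h.2

theorem strictMonoOn_neg_psi_neg (hsupp : μ (Set.Iio 0) = 0) (hδ : (μ {0}).toReal < 1) :
    StrictMonoOn (fun u => -psi μ (-u)) (Set.Ioi 0) := by
  intro a (ha : 0 < a) b (hb : 0 < b) hab
  have hdiff : ∀ x : ℝ, 0 ≤ x → b * x / (1 + b * x) - a * x / (1 + a * x) =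
      (b - a) * x / ((1 + b * x) * (1 + a * x)) := by
    intro x hx
    have h1 : 0 < 1 + b * x := by positivity
    have h2 : 0 < 1 + a * x := by positivity
    field_simp
    ring
  have hint := (integrable_mul_div_one_add_mul hsupp hb).sub
    (integrable_mul_div_one_add_mul hsupp ha)
  have hba : 0 < b - a := sub_pos.2 hab
  have hnn : 0 ≤ᵐ[μ] (fun x => b * x / (1 + b * x)) - fun x => a * x / (1 + a * x) := by
    filter_upwards [ae_nonneg_of_measure_Iio_eq_zero_s9 hsupp] with x hx
    simp only [Pi.sub_apply, Pi.zero_apply, hdiff x hx]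
    positivity
  have hle := integral_nonneg_of_ae hnn
  have heq := integral_sub (integrable_mul_div_one_add_mul hsupp hb)
    (integrable_mul_div_one_add_mul hsupp ha)
  simp only [neg_psi_neg]
  refine sub_pos.1 (heq ▸ lt_of_le_of_ne hle fun h0 => ?_)
  have hz := (integral_eq_zero_iff_of_nonneg_ae hnn hint).1 h0.symm
  have : ∀ᵐ x ∂μ, x ∈ ({0} : Set ℝ) := by
    filter_upwards [hz, ae_nonneg_of_measure_Iio_eq_zero_s9 hsupp] with x hx0 hx
    simp only [Pi.sub_apply, Pi.zero_apply, hdiff x hx] at hx0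
    have h1 : 0 < 1 + b * x := by positivity
    have h2 : 0 < 1 + a * x := by positivity
    have h3 : (1 + b * x) * (1 + a * x) ≠ 0 := by positivity
    simpa [h1.ne', h2.ne', hba.ne'] using hx0
  rw [prob_compl_eq_zero_iff (measurableSet_singleton 0) |>.1 this] at hδ
  simp at hδ

theorem neg_psi_neg_le (hsupp : μ (Set.Iio 0) = 0) {u : ℝ} (hu : 0 < u) :
    -psi μ (-u) ≤ 1 - (μ {0}).toReal := by
  have h0 : 1 - (μ {0}).toReal = ∫ x, ({0}ᶜ : Set ℝ).indicator (fun _ => (1 : ℝ)) x ∂μ := by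
    rw [integral_indicator_const _ (measurableSet_singleton 0).compl,
      probReal_compl_eq_one_sub (measurableSet_singleton 0), smul_eq_mul, mul_one]
    rfl
  rw [neg_psi_neg, h0]
  refine integral_mono_ae (integrable_mul_div_one_add_mul hsupp hu)
    ((integrable_const 1).indicator (measurableSet_singleton 0).compl) ?_
  filter_upwards [ae_nonneg_of_measure_Iio_eq_zero_s9 hsupp] with x hx
  by_cases h : x = 0
  · simp [h]
  · simpa [h] using (mul_div_one_add_mul_mem_Icc hu hx).2

theorem ofReal_neg_psi_neg (hsupp : μ (Set.Iio 0) = 0) {u : ℝ} (hu : 0 < u) :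
    ENNReal.ofReal (-psi μ (-u)) = ∫⁻ x, ENNReal.ofReal (u * x / (1 + u * x)) ∂μ := by
  rw [neg_psi_neg, ofReal_integral_eq_lintegral_ofReal
    (integrable_mul_div_one_add_mul hsupp hu)]
  filter_upwards [ae_nonneg_of_measure_Iio_eq_zero_s9 hsupp] with x hx
  exact (mul_div_one_add_mul_mem_Icc hu hx).1

theorem lintegral_mul_rpow_mul_neg_psi_neg (hsupp : μ (Set.Iio 0) = 0) {γ : ℝ}
    (hγ : γ ∈ Set.Ioo (0 : ℝ) 1) :
    ∫⁻ u in Set.Ioi (0 : ℝ),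
        ENNReal.ofReal (γ * u ^ (-γ - 1)) * ENNReal.ofReal (-psi μ (-u)) =
      ENNReal.ofReal (π * γ / sin (π * γ)) * ∫⁻ x, ENNReal.ofReal (x ^ γ) ∂μ := by
  have hγ0 := hγ.1
  calc
    _ = ∫⁻ u in Set.Ioi (0 : ℝ), ∫⁻ x,
          ENNReal.ofReal (γ * u ^ (-γ - 1)) * ENNReal.ofReal (u * x / (1 + u * x)) ∂μ := by
        refine setLIntegral_congr_fun measurableSet_Ioi fun u (hu : 0 < u) => ?_
        rw [ofReal_neg_psi_neg hsupp hu, lintegral_const_mul _ (by fun_prop)]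
    _ = ∫⁻ x, (∫⁻ u in Set.Ioi (0 : ℝ),
          ENNReal.ofReal (γ * u ^ (-γ - 1)) * ENNReal.ofReal (u * x / (1 + u * x))) ∂μ :=
        lintegral_lintegral_swap (by fun_prop)
    _ = ∫⁻ x, ENNReal.ofReal (π * γ / sin (π * γ)) * ENNReal.ofReal (x ^ γ) ∂μ := by
        refine lintegral_congr_ae ?_
        filter_upwards [ae_nonneg_of_measure_Iio_eq_zero_s9 hsupp] with x hx
        rcases hx.eq_or_lt with rfl | hx
        · simp [hγ0.ne']
        calc
          _ = ∫⁻ u in Set.Ioi (0 : ℝ),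
                ENNReal.ofReal γ * ENNReal.ofReal (u ^ (-γ) * (x / (1 + u * x))) := by
              refine setLIntegral_congr_fun measurableSet_Ioi fun u (hu : 0 < u) => ?_
              have h1 : 0 < 1 + u * x := by positivity
              rw [← ENNReal.ofReal_mul (by positivity), ← ENNReal.ofReal_mul hγ0.le,
                rpow_sub_one hu.ne']
              congr 1
              field_simp
          _ = _ := by
              rw [lintegral_const_mul _ (by fun_prop),
                lintegral_rpow_neg_mul_div_one_add_mul_Ioi hγ hx, ← ENNReal.ofReal_mul hγ0.le,
                ← ENNReal.ofReal_mul' (by positivity)]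
              congr 1
              ring
    _ = _ := lintegral_const_mul _ (by fun_prop)

theorem lintegral_rpow_neg_of_right_inverse (hsupp : μ (Set.Iio 0) = 0)
    (hδ : (μ {0}).toReal < 1) {γ : ℝ} (hγ : 0 < γ) {s : ℝ → ℝ}
    (hs : ∀ t ∈ Set.Ioo 0 (1 - (μ {0}).toReal), 0 < s t ∧ -psi μ (-s t) = t) :
    ∫⁻ t in Set.Ioo 0 (1 - (μ {0}).toReal), ENNReal.ofReal (s t ^ (-γ)) =
      ∫⁻ u in Set.Ioi (0 : ℝ),
        ENNReal.ofReal (γ * u ^ (-γ - 1)) * ENNReal.ofReal (-psi μ (-u)) := by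
  have hmono := strictMonoOn_neg_psi_neg hsupp hδ
  have hmeas : AEMeasurable (fun u => -psi μ (-u)) (volume.restrict (Set.Ioi 0)) :=
    aemeasurable_restrict_of_monotoneOn measurableSet_Ioi hmono.monotoneOn
  calc
    _ = ∫⁻ t in Set.Ioo 0 (1 - (μ {0}).toReal), ∫⁻ u in Set.Ioi (0 : ℝ),
          {p : ℝ × ℝ | p.1 < p.2}.indicator 1 (t, -psi μ (-u)) *
            ENNReal.ofReal (γ * u ^ (-γ - 1)) := by
        refine setLIntegral_congr_fun measurableSet_Ioo fun t ht => ?_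
        obtain ⟨h0, h1⟩ := hs t ht
        rw [← lintegral_mul_rpow_neg_sub_one_Ioi hγ h0, ← lintegral_indicator measurableSet_Ioi,
          ← lintegral_indicator measurableSet_Ioi]
        congr 1
        ext u
        by_cases hu : 0 < u
        · have : t < -psi μ (-u) ↔ s t < u := by
            conv_lhs => rw [← h1]
            exact hmono.lt_iff_lt h0 hu
          by_cases h : s t < u <;> simp [Set.indicator, hu, this, h]
        · have : ¬ s t < u := fun h => hu (h0.trans h)
          simp [Set.indicator, hu, this]
    _ = ∫⁻ u in Set.Ioi (0 : ℝ), ∫⁻ t in Set.Ioo 0 (1 - (μ {0}).toReal),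
          {p : ℝ × ℝ | p.1 < p.2}.indicator 1 (t, -psi μ (-u)) *
            ENNReal.ofReal (γ * u ^ (-γ - 1)) := by
        refine lintegral_lintegral_swap (AEMeasurable.mul ?_ (by fun_prop))
        have hind : Measurable ({p : ℝ × ℝ | p.1 < p.2}.indicator (1 : ℝ × ℝ → ENNReal)) :=
          measurable_one.indicator (measurableSet_lt measurable_fst measurable_snd)
        exact hind.comp_aemeasurable (measurable_fst.aemeasurable.prodMk hmeas.comp_snd)
    _ = _ := by
        refine setLIntegral_congr_fun measurableSet_Ioi fun u (hu : 0 < u) => ?_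
        have hle := neg_psi_neg_le hsupp hu
        rw [lintegral_mul_const' _ _ ENNReal.ofReal_ne_top, mul_comm]
        congr 1
        have : ∀ t : ℝ, {p : ℝ × ℝ | p.1 < p.2}.indicator (1 : ℝ × ℝ → ENNReal)
            (t, -psi μ (-u)) = (Set.Iio (-psi μ (-u))).indicator 1 t := fun t => rfl
        simp_rw [this]
        rw [lintegral_indicator_one measurableSet_Iio, Measure.restrict_apply measurableSet_Iio,
          show Set.Iio (-psi μ (-u)) ∩ Set.Ioo 0 (1 - (μ {0}).toReal) =
            Set.Ioo 0 (-psi μ (-u)) by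
            ext t
            simp only [Set.mem_inter_iff, Set.mem_Iio, Set.mem_Ioo]
            exact ⟨fun h => ⟨h.2.1, h.1⟩, fun h => ⟨h.2, h.1, h.2.trans_le hle⟩⟩,
          Real.volume_Ioo, sub_zero]

theorem monotoneOn_of_right_inverse (hsupp : μ (Set.Iio 0) = 0)
    (hδ : (μ {0}).toReal < 1) {s : ℝ → ℝ} {m : ℝ}
    (hs : ∀ t ∈ Set.Ioo 0 m, 0 < s t ∧ -psi μ (-s t) = t) :
    MonotoneOn s (Set.Ioo 0 m) := by
  intro a ha b hb hab
  refine ((strictMonoOn_neg_psi_neg hsupp hδ).le_iff_le (hs a ha).1 (hs b hb).1).1 ?_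
  simpa only [(hs a ha).2, (hs b hb).2] using hab

end

/-- Fractional moments via the inverse of the moment transform: for a probability
measure `μ` on `[0,∞)` with `δ = μ({0}) < 1`, `γ ∈ (0,1)` with `m_γ(μ) < ∞`, and `χ`
the inverse of `ψ_μ` on `(δ-1,0)`:
`∫ x^γ dμ(x) = (sin(πγ)/(πγ)) ∫₀^{1-δ} (-χ(-t))^{-γ} dt`. -/
theorem fractional_moment_formula
    (μ : Measure ℝ) [IsProbabilityMeasure μ] (hsupp : μ (Set.Iio 0) = 0)
    (hδ : (μ {0}).toReal < 1)
    (γ : ℝ) (hγ : γ ∈ Set.Ioo (0 : ℝ) 1)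
    (hmγ : Integrable (fun x : ℝ => x ^ γ) μ)
    (χ : ℝ → ℝ)
    (hχ : ∀ z ∈ Set.Ioo ((μ {0}).toReal - 1) 0, χ z < 0 ∧ psi μ (χ z) = z) :
    ∫ x, x ^ γ ∂μ =
      (Real.sin (π * γ) / (π * γ)) *
        ∫ t in (0 : ℝ)..(1 - (μ {0}).toReal), (-χ (-t)) ^ (-γ) := by
  have hs : ∀ t ∈ Set.Ioo 0 (1 - (μ {0}).toReal),
      0 < -χ (-t) ∧ -psi μ (-(-χ (-t))) = t := by
    intro t ht
    have h := hχ (-t) ⟨by linarith [ht.2], by linarith [ht.1]⟩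
    rw [neg_neg, h.2, neg_neg]
    exact ⟨neg_pos.2 h.1, rfl⟩
  have hsin : 0 < sin (π * γ) :=
    sin_pos_of_pos_of_lt_pi (mul_pos pi_pos hγ.1) (by nlinarith [pi_pos, hγ.2])
  have hπγ : 0 < π * γ := mul_pos pi_pos hγ.1
  have hL : ∫ x, x ^ γ ∂μ = (∫⁻ x, ENNReal.ofReal (x ^ γ) ∂μ).toReal := by
    refine integral_eq_lintegral_of_nonneg_ae ?_ hmγ.aestronglyMeasurable
    filter_upwards [ae_nonneg_of_measure_Iio_eq_zero_s9 hsupp] with x hx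
    exact rpow_nonneg hx γ
  have hR : ∫ t in (0 : ℝ)..(1 - (μ {0}).toReal), (-χ (-t)) ^ (-γ) =
      (∫⁻ t in Set.Ioo 0 (1 - (μ {0}).toReal), ENNReal.ofReal ((-χ (-t)) ^ (-γ))).toReal := by
    rw [intervalIntegral.integral_of_le (sub_nonneg.2 hδ.le), integral_Ioc_eq_integral_Ioo]
    refine integral_eq_lintegral_of_nonneg_ae ?_ ?_
    · filter_upwards [ae_restrict_mem measurableSet_Ioo] with t ht
      exact rpow_nonneg (hs t ht).1.le _
    · exact ((aemeasurable_restrict_of_monotoneOn measurableSet_Ioo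
        (monotoneOn_of_right_inverse hsupp hδ hs)).pow_const (-γ)).aestronglyMeasurable
  rw [hL, hR, lintegral_rpow_neg_of_right_inverse hsupp hδ hγ.1 hs,
    lintegral_mul_rpow_mul_neg_psi_neg hsupp hγ, ENNReal.toReal_mul,
    ENNReal.toReal_ofReal (by positivity)]
  have := hγ.1.ne'
  field_simp
end
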